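/- arXiv:2303.08938 — 6 statements merged into one kernel-verified Lean document; each statement's English description precedes it below -/
import Mathlib

section
/- Let ψ be a unit vector in ℂ^d and let ρ be a density matrix of the same size. Then re Tr(ψψ†·ρ) ≤ 1 − ‖ψψ† − ρ‖₁² / 4, where ψψ† − ρ is Hermitian so its trace norm is defined. -/
open Matrix
open scoped ComplexOrder

/-- The trace norm of a Hermitian matrix: the sum of the absolute values of its
eigenvalues. -/
noncomputable def traceNorm {d : Type*} [Fintype d] [DecidableEq d]
    {A : Matrix d d ℂ} (hA : A.IsHermitian) : ℝ :=
  ∑ i, |hA.eigenvalues i|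

/-- The Cauchy–Schwarz bound on the total variation of two squared unit vectors. -/
lemma sum_abs_sq_sub_sq_sq_le {ι : Type*} [Fintype ι] (a t : ι → ℝ)
    (ha : ∑ i, a i ^ 2 = 1) (ht : ∑ i, t i ^ 2 = 1) :
    (∑ i, |a i ^ 2 - t i ^ 2|) ^ 2 ≤ 4 * (1 - (∑ i, a i * t i) ^ 2) := by
  have h := Finset.sum_mul_sq_le_sq_mul_sq Finset.univ (fun i => |a i - t i|) (fun i => |a i + t i|)
  have e : ∀ i, |a i - t i| * |a i + t i| = |a i ^ 2 - t i ^ 2| := fun i => by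
    rw [← abs_mul]; ring_nf
  have h₁ : ∑ i, |a i - t i| ^ 2 = 2 - 2 * ∑ i, a i * t i := by
    simp only [sq_abs, sub_sq, Finset.sum_add_distrib, Finset.sum_sub_distrib, ha, ht, mul_assoc,
      ← Finset.mul_sum]
    ring
  have h₂ : ∑ i, |a i + t i| ^ 2 = 2 + 2 * ∑ i, a i * t i := by
    simp only [sq_abs, add_sq, Finset.sum_add_distrib, ha, ht, mul_assoc, ← Finset.mul_sum]
    ring
  simp only [e, h₁, h₂] at h
  linarith

lemma re_star_dotProduct_self {d : ℕ} (v : Fin d → ℂ) :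
    (star v ⬝ᵥ v).re = ‖WithLp.toLp 2 v‖ ^ 2 := by
  rw [EuclideanSpace.norm_sq_eq, dotProduct, Complex.re_sum]
  refine Finset.sum_congr rfl fun i _ => ?_
  rw [Pi.star_apply, Complex.star_def, ← Complex.normSq_eq_conj_mul_self, Complex.ofReal_re,
    Complex.normSq_eq_norm_sq]

lemma star_dotProduct_vecMulVec_mulVec_re {d : ℕ} (u ψ : Fin d → ℂ) :
    (star u ⬝ᵥ vecMulVec ψ (star ψ) *ᵥ u).re =
      ‖inner ℂ (WithLp.toLp 2 u) (WithLp.toLp 2 ψ)‖ ^ 2 := by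
  have h : star ψ ⬝ᵥ u = star (star u ⬝ᵥ ψ) := star_dotProduct ψ u
  rw [vecMulVec_mulVec, EuclideanSpace.inner_toLp_toLp, dotProduct_comm ψ (star u), h,
    op_smul_eq_smul, dotProduct_smul, smul_eq_mul, Complex.star_def,
    ← Complex.normSq_eq_conj_mul_self, Complex.ofReal_re, Complex.normSq_eq_norm_sq]

lemma star_dotProduct_conjTranspose_mul_self_mulVec_re {d : ℕ} (B : Matrix (Fin d) (Fin d) ℂ)
    (v : Fin d → ℂ) :
    (star v ⬝ᵥ (Bᴴ * B) *ᵥ v).re = ‖toEuclideanLin B (WithLp.toLp 2 v)‖ ^ 2 := by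
  rw [← mulVec_mulVec, dotProduct_mulVec, ← star_mulVec, re_star_dotProduct_self]
  rfl

/-- For a unit vector `ψ` in `ℂ^d` and a density matrix `ρ`,
`re Tr(ψψ†·ρ) ≤ 1 − ‖ψψ† − ρ‖₁² / 4`. -/
theorem fidelity_trace_norm_bound
    (d : ℕ) (ψ : Fin d → ℂ) (hψ : star ψ ⬝ᵥ ψ = 1)
    (ρ : Matrix (Fin d) (Fin d) ℂ) (hρ : ρ.PosSemidef) (hρtr : ρ.trace = 1)
    (hA : (vecMulVec ψ (star ψ) - ρ).IsHermitian) :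
    ((vecMulVec ψ (star ψ) * ρ).trace).re ≤ 1 - (traceNorm hA) ^ 2 / 4 := by
  obtain ⟨B, rfl⟩ : ∃ B : Matrix (Fin d) (Fin d) ℂ, ρ = Bᴴ * B := by
    open scoped MatrixOrder Matrix.Norms.L2Operator in
    exact CStarAlgebra.nonneg_iff_eq_star_mul_self.mp hρ.nonneg
  let b := hA.eigenvectorBasis
  let Ψ : EuclideanSpace ℂ (Fin d) := WithLp.toLp 2 ψ
  let a : Fin d → ℝ := fun i => ‖inner ℂ (b i) Ψ‖
  let t : Fin d → ℝ := fun i => ‖toEuclideanLin B (b i)‖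
  have hev : ∀ i, hA.eigenvalues i = a i ^ 2 - t i ^ 2 := fun i => by
    rw [hA.eigenvalues_eq, sub_mulVec, dotProduct_sub, map_sub]
    exact congrArg₂ _ (star_dotProduct_vecMulVec_mulVec_re _ _)
      (star_dotProduct_conjTranspose_mul_self_mulVec_re _ _)
  have ha : ∑ i, a i ^ 2 = 1 := by
    rw [b.sum_sq_norm_inner_right, ← re_star_dotProduct_self, hψ, Complex.one_re]
  have ht : ∑ i, t i ^ 2 = 1 := by
    have h := congrArg Complex.re hA.trace_eq_sum_eigenvalues
    rw [trace_sub, hρtr, trace_vecMulVec, dotProduct_comm, hψ, sub_self, Complex.re_sum] at h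
    simp only [Complex.coe_algebraMap, Complex.ofReal_re, hev,
      Finset.sum_sub_distrib, ha, Complex.zero_re] at h
    linarith
  have hF : ((vecMulVec ψ (star ψ) * (Bᴴ * B)).trace).re = ‖toEuclideanLin B Ψ‖ ^ 2 := by
    rw [← star_dotProduct_conjTranspose_mul_self_mulVec_re, vecMulVec_mul, trace_vecMulVec,
      dotProduct_comm, dotProduct_mulVec]
  have hB : ‖toEuclideanLin B Ψ‖ ≤ ∑ i, a i * t i := by
    conv_lhs => rw [← b.sum_repr' Ψ]
    rw [map_sum]
    refine (norm_sum_le _ _).trans_eq (Finset.sum_congr rfl fun i _ => ?_)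
    rw [map_smul, norm_smul]
  have hS := sum_abs_sq_sub_sq_sq_le a t ha ht
  have hsq := pow_le_pow_left₀ (norm_nonneg _) hB 2
  rw [hF, traceNorm]
  simp only [hev]
  linarith
end

section
/- Let s₁,…,s_m be subsets of the n sites and let H = Σᵢ₌₁^m lift(hᵢ,sᵢ) where each hᵢ is a Hermitian matrix indexed by (sᵢ → Fin 2) with 0 ≤ hᵢ ≤ I. Let ψ be a unit vector that is the unique ground state of H with ground energy λ and spectral gap at least Δ > 0. Then for any ε > 0 and any n-qubit density matrix ρ, at least one of the following holds: (1) ‖ψψ† − ρ‖₁ < ε; or (2) there exists an index i with ‖(ψψ†)_{sᵢ} − ρ_{sᵢ}‖₁ ≥ Δε² / (4m). -/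
open Matrix
open scoped ComplexOrder

/-- The type of configurations of `n` qubits. -/
abbrev QConf (n : ℕ) := Fin n → Fin 2

/-- An `n`-qubit matrix. -/
abbrev QMatrix (n : ℕ) := Matrix (QConf n) (QConf n) ℂ

/-- Combine a configuration `f` on the sites in `s` with a configuration `h` on the
complementary sites into a configuration on all `n` sites. -/
def mergeConf {n : ℕ} (s : Finset (Fin n)) (f : ↥s → Fin 2) (h : ↥sᶜ → Fin 2) :
    QConf n :=
  fun i => if hi : i ∈ s then f ⟨i, hi⟩ else h ⟨i, Finset.mem_compl.mpr hi⟩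

/-- The reduced density matrix of an `n`-qubit matrix `ρ` on the subset `s` of sites
(partial trace over the complement of `s`). -/
noncomputable def reduce {n : ℕ} (ρ : QMatrix n) (s : Finset (Fin n)) :
    Matrix (↥s → Fin 2) (↥s → Fin 2) ℂ :=
  fun f g => ∑ h : ↥sᶜ → Fin 2, ρ (mergeConf s f h) (mergeConf s g h)

/-- The lift of a matrix `h` on the sites in `s` to an `n`-qubit matrix:
`h` tensored with the identity on the complement of `s`. -/
def liftMat {n : ℕ} (s : Finset (Fin n)) (h : Matrix (↥s → Fin 2) (↥s → Fin 2) ℂ) :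
    QMatrix n :=
  fun F G =>
    if ∀ i : ↥sᶜ, F i = G i then h (fun i : ↥s => F i) (fun i : ↥s => G i) else 0

open scoped InnerProductSpace

theorem abs_norm_sq_sub_norm_sq_le (x y : ℂ) :
    |‖x‖ ^ 2 - ‖y‖ ^ 2| ≤ ‖x - y‖ * ‖x + y‖ := by
  have h : ‖x‖ ^ 2 - ‖y‖ ^ 2 = (star (x - y) * (x + y)).re := by
    rw [Complex.sq_norm, Complex.sq_norm, Complex.normSq_apply, Complex.normSq_apply]
    simp
    ring
  rw [h]
  refine (Complex.abs_re_le_norm _).trans ?_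
  rw [norm_mul, norm_star]

theorem exists_norm_eq_one_mul_eq_norm (w : ℂ) : ∃ z : ℂ, ‖z‖ = 1 ∧ z * w = (‖w‖ : ℂ) := by
  by_cases hw : w = 0
  · exact ⟨1, by simp, by simp [hw]⟩
  · have hn : (‖w‖ : ℂ) ≠ 0 := by simpa using hw
    refine ⟨star w / ‖w‖, by simp [hw], ?_⟩
    rw [div_mul_eq_mul_div, div_eq_iff hn, Complex.star_def, Complex.conj_mul', sq]

/-- The measurement statistics of `ψ` (scaled to the norm of `b`) and of `b` in an orthonormal
basis differ in `ℓ¹` by at most the trace distance of the corresponding pure states. -/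
theorem sum_abs_sq_norm_inner_sub_le {E ι : Type*} [NormedAddCommGroup E] [InnerProductSpace ℂ E]
    [Fintype ι] (u : OrthonormalBasis ι ℂ E) (ψ b : E) (hψ : ‖ψ‖ = 1) :
    ∑ j, |‖b‖ ^ 2 * ‖⟪u j, ψ⟫_ℂ‖ ^ 2 - ‖⟪u j, b⟫_ℂ‖ ^ 2| ≤
      2 * (√(‖b‖ ^ 2) * √(‖b‖ ^ 2 - ‖⟪ψ, b⟫_ℂ‖ ^ 2)) := by
  obtain ⟨z, hz, hzw⟩ := exists_norm_eq_one_mul_eq_norm ⟪ψ, b⟫_ℂ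
  set x : E := (‖b‖ : ℂ) • ψ with hx
  set y : E := z • b with hy
  have hxn : ‖x‖ = ‖b‖ := by simp [hx, norm_smul, hψ]
  have hyn : ‖y‖ = ‖b‖ := by simp [hy, norm_smul, hz]
  have hxy : RCLike.re ⟪x, y⟫_ℂ = ‖b‖ * ‖⟪ψ, b⟫_ℂ‖ := by
    rw [hx, hy, inner_smul_left, inner_smul_right, hzw, Complex.conj_ofReal, ← Complex.ofReal_mul]
    exact Complex.ofReal_re _
  calc
    _ = ∑ j, |‖⟪u j, x⟫_ℂ‖ ^ 2 - ‖⟪u j, y⟫_ℂ‖ ^ 2| := by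
      refine Finset.sum_congr rfl fun j _ => ?_
      rw [hx, hy, inner_smul_right, inner_smul_right, norm_mul, norm_mul, hz]
      simp [mul_pow]
    _ ≤ ∑ j, ‖⟪u j, x - y⟫_ℂ‖ * ‖⟪u j, x + y⟫_ℂ‖ := by
      refine Finset.sum_le_sum fun j _ => ?_
      rw [inner_sub_right, inner_add_right]
      exact abs_norm_sq_sub_norm_sq_le _ _
    _ ≤ √(‖x - y‖ ^ 2) * √(‖x + y‖ ^ 2) := by
      rw [← u.sum_sq_norm_inner_right, ← u.sum_sq_norm_inner_right]
      exact Real.sum_mul_le_sqrt_mul_sqrt _ _ _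
    _ = √(2 ^ 2 * (‖b‖ ^ 2 * (‖b‖ ^ 2 - ‖⟪ψ, b⟫_ℂ‖ ^ 2))) := by
      rw [← Real.sqrt_mul (by positivity), norm_sub_sq (𝕜 := ℂ), norm_add_sq (𝕜 := ℂ), hxy, hxn,
        hyn]
      congr 1
      ring
    _ = _ := by
      rw [Real.sqrt_mul (by positivity), Real.sqrt_sq (by norm_num), Real.sqrt_mul (by positivity)]

theorem Matrix.PosSemidef.exists_eq_conjTranspose_mul_self {d : Type*} [Fintype d] [DecidableEq d]
    {ρ : Matrix d d ℂ} (hρ : ρ.PosSemidef) : ∃ B : Matrix d d ℂ, ρ = Bᴴ * B := by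
  open scoped MatrixOrder in
  exact CStarAlgebra.nonneg_iff_eq_star_mul_self.mp hρ.nonneg

theorem Matrix.trace_mul_conjTranspose_mul_self {d : Type*} [Fintype d]
    (M B : Matrix d d ℂ) :
    (M * (Bᴴ * B)).trace = ∑ k, star (star (B k)) ⬝ᵥ (M *ᵥ star (B k)) := by
  rw [← Matrix.mul_assoc, Matrix.trace_mul_comm, ← Matrix.mul_assoc]
  simp only [trace, diag, Matrix.mul_apply, dotProduct, mulVec, Finset.mul_sum, Finset.sum_mul,
    conjTranspose_apply, Pi.star_apply, star_star]
  refine Finset.sum_congr rfl fun k _ => ?_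
  rw [Finset.sum_comm]
  simp only [mul_assoc]

theorem Matrix.star_dotProduct_conjTranspose_mul_self_mulVec {d : Type*} [Fintype d]
    (B : Matrix d d ℂ) (v : d → ℂ) :
    (star v ⬝ᵥ ((Bᴴ * B) *ᵥ v)) = ((∑ k, ‖star v ⬝ᵥ star (B k)‖ ^ 2 : ℝ) : ℂ) := by
  rw [← mulVec_mulVec, dotProduct_mulVec, ← star_mulVec]
  simp only [dotProduct, Pi.star_apply, Complex.ofReal_sum]
  refine Finset.sum_congr rfl fun k _ => ?_
  rw [Complex.star_def, Complex.conj_mul', mulVec, ← norm_star (B k ⬝ᵥ v), Complex.ofReal_pow]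
  simp [dotProduct, mul_comm]

theorem Matrix.star_dotProduct_vecMulVec_mulVec {d : Type*} [Fintype d]
    (ψ v : d → ℂ) :
    star v ⬝ᵥ (vecMulVec ψ (star ψ) *ᵥ v) = ((‖star v ⬝ᵥ ψ‖ ^ 2 : ℝ) : ℂ) := by
  have h : star ψ ⬝ᵥ v = star (star v ⬝ᵥ ψ) := star_dotProduct ψ v
  rw [vecMulVec_mulVec, Complex.ofReal_pow, ← Complex.mul_conj', dotProduct_smul, h]
  simp

/-- Fuchs–van de Graaf inequality for a pure state and a density matrix `Bᴴ * B`. -/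
theorem traceNorm_vecMulVec_sub_le {d : Type*} [Fintype d] [DecidableEq d] (ψ : d → ℂ)
    (hψ : star ψ ⬝ᵥ ψ = 1) (B : Matrix d d ℂ) (hB : ∑ k, ‖WithLp.toLp 2 (star (B k))‖ ^ 2 = 1)
    (hA : (vecMulVec ψ (star ψ) - Bᴴ * B).IsHermitian) :
    traceNorm hA ≤ 2 * √(1 - ∑ k, ‖star ψ ⬝ᵥ star (B k)‖ ^ 2) := by
  set u := hA.eigenvectorBasis
  have hin : ∀ v w : d → ℂ, ⟪WithLp.toLp 2 v, WithLp.toLp 2 w⟫_ℂ = star v ⬝ᵥ w := fun v w => by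
    rw [EuclideanSpace.inner_toLp_toLp, dotProduct_comm]
  have hψn : ‖WithLp.toLp 2 ψ‖ = 1 := by
    have h : ((‖WithLp.toLp 2 ψ‖ : ℂ)) ^ 2 = 1 := by
      rw [← hψ, ← hin]
      exact (inner_self_eq_norm_sq_to_K (𝕜 := ℂ) (WithLp.toLp 2 ψ)).symm
    have h' : ‖WithLp.toLp 2 ψ‖ ^ 2 = 1 := by exact_mod_cast h
    exact (pow_eq_one_iff_of_nonneg (norm_nonneg _) two_ne_zero).mp h'
  have hev : ∀ j, hA.eigenvalues j = ∑ k, (‖WithLp.toLp 2 (star (B k))‖ ^ 2 *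
      ‖⟪u j, WithLp.toLp 2 ψ⟫_ℂ‖ ^ 2 - ‖⟪u j, WithLp.toLp 2 (star (B k))⟫_ℂ‖ ^ 2) := fun j => by
    have hj : ∀ v : d → ℂ, ⟪u j, WithLp.toLp 2 v⟫_ℂ = star ⇑(u j) ⬝ᵥ v := fun v => hin _ v
    rw [hA.eigenvalues_eq, sub_mulVec, dotProduct_sub,
      Matrix.star_dotProduct_conjTranspose_mul_self_mulVec,
      Matrix.star_dotProduct_vecMulVec_mulVec, Finset.sum_sub_distrib, ← Finset.sum_mul, hB,
      ← Complex.ofReal_sub]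
    simp only [hj, one_mul]
    exact Complex.ofReal_re _
  calc
    traceNorm hA ≤ ∑ j, ∑ k, |‖WithLp.toLp 2 (star (B k))‖ ^ 2 *
        ‖⟪u j, WithLp.toLp 2 ψ⟫_ℂ‖ ^ 2 - ‖⟪u j, WithLp.toLp 2 (star (B k))⟫_ℂ‖ ^ 2| := by
      refine Finset.sum_le_sum fun j _ => ?_
      rw [hev]
      exact Finset.abs_sum_le_sum_abs _ _
    _ ≤ ∑ k, 2 * (√(‖WithLp.toLp 2 (star (B k))‖ ^ 2) * √(‖WithLp.toLp 2 (star (B k))‖ ^ 2 -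
        ‖⟪WithLp.toLp 2 ψ, WithLp.toLp 2 (star (B k))⟫_ℂ‖ ^ 2)) := by
      rw [Finset.sum_comm]
      exact Finset.sum_le_sum fun k _ => sum_abs_sq_norm_inner_sub_le u _ _ hψn
    _ ≤ 2 * (√(∑ k, ‖WithLp.toLp 2 (star (B k))‖ ^ 2) *
        √(∑ k, (‖WithLp.toLp 2 (star (B k))‖ ^ 2 -
          ‖⟪WithLp.toLp 2 ψ, WithLp.toLp 2 (star (B k))⟫_ℂ‖ ^ 2))) := by
      rw [← Finset.mul_sum]
      refine mul_le_mul_of_nonneg_left ?_ (by norm_num)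
      refine Real.sum_sqrt_mul_sqrt_le _ (fun k => by positivity) fun k => ?_
      have h := norm_inner_le_norm (𝕜 := ℂ) (WithLp.toLp 2 ψ) (WithLp.toLp 2 (star (B k)))
      rw [hψn, one_mul] at h
      exact sub_nonneg.mpr (pow_le_pow_left₀ (norm_nonneg _) h 2)
    _ = _ := by
      rw [Finset.sum_sub_distrib, hB, Real.sqrt_one, one_mul]
      simp only [hin]

/-- An effect `0 ≤ h ≤ 1` cannot distinguish better than the trace norm. -/
theorem abs_trace_mul_re_le_traceNorm {d : Type*} [Fintype d] [DecidableEq d]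
    {h A : Matrix d d ℂ} (hpos : h.PosSemidef) (hle : (1 - h).PosSemidef) (hA : A.IsHermitian) :
    |(h * A).trace.re| ≤ traceNorm hA := by
  set U : Matrix d d ℂ := (hA.eigenvectorUnitary : Matrix d d ℂ) with hU
  have hUU : Uᴴ * U = 1 := Unitary.coe_star_mul_self hA.eigenvectorUnitary
  have h0 : ∀ j, 0 ≤ ((Uᴴ * h * U) j j).re := fun j =>
    (Complex.le_def.mp (hpos.conjTranspose_mul_mul_same U).diag_nonneg).1
  have h1 : ∀ j, ((Uᴴ * h * U) j j).re ≤ 1 := fun j => by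
    have := (Complex.le_def.mp ((hle.conjTranspose_mul_mul_same U).diag_nonneg (i := j))).1
    rw [Matrix.mul_sub, Matrix.sub_mul, Matrix.mul_one, hUU] at this
    simpa using this
  have htr : (h * A).trace.re = ∑ j, ((Uᴴ * h * U) j j).re * hA.eigenvalues j := by
    conv_lhs => rw [hA.spectral_theorem, Unitary.conjStarAlgAut_apply]
    rw [← hU, ← Matrix.mul_assoc, ← Matrix.mul_assoc, Matrix.trace_mul_comm, ← Matrix.mul_assoc,
      ← Matrix.mul_assoc, ← Matrix.star_eq_conjTranspose]
    simp [trace, Matrix.mul_diagonal, hU]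
  rw [htr]
  refine (Finset.abs_sum_le_sum_abs _ _).trans (Finset.sum_le_sum fun j _ => ?_)
  rw [abs_mul, abs_of_nonneg (h0 j)]
  exact mul_le_of_le_one_left (abs_nonneg _) (h1 j)

/-- Splitting a configuration into its restrictions to `s` and to the complement of `s`. -/
def confEquiv {n : ℕ} (s : Finset (Fin n)) :
    (↥s → Fin 2) × (↥sᶜ → Fin 2) ≃ QConf n where
  toFun p := mergeConf s p.1 p.2
  invFun F := (fun i => F i, fun i => F i)
  left_inv p := by
    ext i
    · simp [mergeConf]
    · have := Finset.mem_compl.mp i.2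
      simp [mergeConf, this]
  right_inv F := by
    ext i
    simp [mergeConf]

theorem liftMat_mergeConf {n : ℕ} (s : Finset (Fin n)) (h : Matrix (↥s → Fin 2) (↥s → Fin 2) ℂ)
    (f g : ↥s → Fin 2) (a b : ↥sᶜ → Fin 2) :
    liftMat s h (mergeConf s f a) (mergeConf s g b) = if a = b then h f g else 0 := by
  have hr : ∀ (f : ↥s → Fin 2) (a : ↥sᶜ → Fin 2), (fun i : ↥s => mergeConf s f a i) = f :=
    fun f a => congrArg Prod.fst ((confEquiv s).left_inv (f, a))
  have hc : ∀ (f : ↥s → Fin 2) (a : ↥sᶜ → Fin 2), (fun i : ↥sᶜ => mergeConf s f a i) = a :=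
    fun f a => congrArg Prod.snd ((confEquiv s).left_inv (f, a))
  have hab : (∀ i : ↥sᶜ, mergeConf s f a i = mergeConf s g b i) ↔ a = b := by
    rw [← funext_iff, hc, hc]
  simp only [liftMat, hr, hab]

theorem trace_liftMat_mul {n : ℕ} (s : Finset (Fin n)) (h : Matrix (↥s → Fin 2) (↥s → Fin 2) ℂ)
    (ρ : QMatrix n) : (liftMat s h * ρ).trace = (h * reduce ρ s).trace := by
  have hsum : ∀ φ : QConf n → ℂ, ∑ F, φ F = ∑ f, ∑ a, φ (mergeConf s f a) := fun φ => by
    rw [← (confEquiv s).sum_comp, Fintype.sum_prod_type]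
    rfl
  simp only [trace, diag, Matrix.mul_apply, hsum, liftMat_mergeConf, reduce, Finset.mul_sum]
  refine Finset.sum_congr rfl fun f _ => ?_
  rw [Finset.sum_comm]
  refine Finset.sum_congr rfl fun g _ => ?_
  simp

theorem liftMat_isHermitian {n : ℕ} (s : Finset (Fin n))
    {h : Matrix (↥s → Fin 2) (↥s → Fin 2) ℂ} (hh : h.IsHermitian) :
    (liftMat s h).IsHermitian := by
  ext F G
  simp only [conjTranspose_apply, liftMat, eq_comm (a := G _)]
  split_ifs
  · exact hh.apply _ _
  · simp

/-- A Hermitian matrix with unique ground state `ψ` and gap `Δ` has energy at least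
`lam ‖b‖² + Δ (‖b‖² - |⟨ψ, b⟩|²)` in the state `b`. -/
theorem gap_energy_le {d : Type*} [Fintype d] {H : Matrix d d ℂ} (hH : H.IsHermitian)
    {ψ : d → ℂ} (hψ : star ψ ⬝ᵥ ψ = 1) {lam Δ : ℝ} (hground : H *ᵥ ψ = (lam : ℂ) • ψ)
    (hgap : ∀ v : d → ℂ, star ψ ⬝ᵥ v = 0 →
      (lam + Δ) * (star v ⬝ᵥ v).re ≤ (star v ⬝ᵥ (H *ᵥ v)).re) (b : d → ℂ) :
    lam * (star b ⬝ᵥ b).re + Δ * ((star b ⬝ᵥ b).re - ‖star ψ ⬝ᵥ b‖ ^ 2) ≤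
      (star b ⬝ᵥ (H *ᵥ b)).re := by
  set c := star ψ ⬝ᵥ b with hc
  set w := b - c • ψ with hw
  have hψw : star ψ ⬝ᵥ w = 0 := by
    rw [hw, dotProduct_sub, dotProduct_smul, hψ, ← hc]
    simp
  have hwψ : star w ⬝ᵥ ψ = 0 := by
    rw [star_dotProduct, hψw, star_zero]
  have hψHw : star ψ ⬝ᵥ (H *ᵥ w) = 0 := by
    rw [dotProduct_mulVec, ← hH.eq, ← star_mulVec, hground, star_smul, smul_dotProduct, hψw,
      smul_zero]
  have hb : b = c • ψ + w := by rw [hw]; abel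
  have hcc : star c * c = ((‖c‖ ^ 2 : ℝ) : ℂ) := by
    rw [Complex.star_def, Complex.conj_mul', Complex.ofReal_pow]
  have hN : (star b ⬝ᵥ b).re = ‖c‖ ^ 2 + (star w ⬝ᵥ w).re := by
    have : star b ⬝ᵥ b = ((‖c‖ ^ 2 : ℝ) : ℂ) + star w ⬝ᵥ w := by
      rw [hb, star_add, star_smul]
      simp only [add_dotProduct, dotProduct_add, smul_dotProduct, dotProduct_smul, hψw, hwψ, hψ,
        smul_eq_mul, ← hcc]
      ring
    rw [this, Complex.add_re, Complex.ofReal_re]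
  have hE : (star b ⬝ᵥ (H *ᵥ b)).re = lam * ‖c‖ ^ 2 + (star w ⬝ᵥ (H *ᵥ w)).re := by
    have : star b ⬝ᵥ (H *ᵥ b) = ((lam * ‖c‖ ^ 2 : ℝ) : ℂ) + star w ⬝ᵥ (H *ᵥ w) := by
      rw [hb, star_add, star_smul, mulVec_add, mulVec_smul, hground, Complex.ofReal_mul, ← hcc]
      simp only [add_dotProduct, dotProduct_add, smul_dotProduct, dotProduct_smul, hψHw, hwψ, hψ,
        smul_eq_mul]
      ring
    rw [this, Complex.add_re, Complex.ofReal_re]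
  have := hgap w hψw
  rw [hN, hE]
  linarith

/-- Let `H = Σᵢ lift(hᵢ,sᵢ)` be a local Hamiltonian with Hermitian terms
`0 ≤ hᵢ ≤ I` and let `ψ` be its unique ground state with spectral gap at least `Δ > 0`.
Then for every `ε > 0` and every `n`-qubit density matrix `ρ`, either
`‖ψψ† − ρ‖₁ < ε`, or some local reduced density matrix deviates:
`‖(ψψ†)_{sᵢ} − ρ_{sᵢ}‖₁ ≥ Δε²/(4m)` for some `i`. -/
theorem ground_state_marginal_dichotomy
    (n m : ℕ) (s : Fin m → Finset (Fin n))
    (hmat : ∀ i, Matrix (↥(s i) → Fin 2) (↥(s i) → Fin 2) ℂ)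
    (hHerm : ∀ i, (hmat i).IsHermitian)
    (hpos : ∀ i, (hmat i).PosSemidef)
    (hle : ∀ i, ((1 : Matrix (↥(s i) → Fin 2) (↥(s i) → Fin 2) ℂ) - hmat i).PosSemidef)
    (ψ : QConf n → ℂ) (hψ : star ψ ⬝ᵥ ψ = 1)
    (lam Δ : ℝ) (hΔ : 0 < Δ)
    (hground : (∑ i, liftMat (s i) (hmat i)) *ᵥ ψ = (lam : ℂ) • ψ)
    (hgap : ∀ v : QConf n → ℂ, star ψ ⬝ᵥ v = 0 →
      (lam + Δ) * (star v ⬝ᵥ v).re ≤ (star v ⬝ᵥ ((∑ i, liftMat (s i) (hmat i)) *ᵥ v)).re)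
    (ε : ℝ) (hε : 0 < ε)
    (ρ : QMatrix n) (hρ : ρ.PosSemidef) (hρtr : ρ.trace = 1)
    (hA : (vecMulVec ψ (star ψ) - ρ).IsHermitian)
    (hAs : ∀ i, (reduce (vecMulVec ψ (star ψ)) (s i) - reduce ρ (s i)).IsHermitian) :
    traceNorm hA < ε ∨ ∃ i, Δ * ε ^ 2 / (4 * m) ≤ traceNorm (hAs i) := by
  by_contra! hcon
  obtain ⟨hε', hloc⟩ := hcon
  obtain ⟨B, rfl⟩ := hρ.exists_eq_conjTranspose_mul_self
  set H : QMatrix n := ∑ i, liftMat (s i) (hmat i) with hH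
  have hHH : H.IsHermitian := by
    rw [Matrix.IsHermitian, hH, conjTranspose_sum]
    exact Finset.sum_congr rfl fun i _ => liftMat_isHermitian _ (hHerm i)
  have hnorm : ∀ k, (star (star (B k)) ⬝ᵥ star (B k)).re = ‖WithLp.toLp 2 (star (B k))‖ ^ 2 :=
    fun k => by
      rw [dotProduct_comm, ← EuclideanSpace.inner_toLp_toLp]
      exact inner_self_eq_norm_sq (𝕜 := ℂ) _
  have hB : ∑ k, ‖WithLp.toLp 2 (star (B k))‖ ^ 2 = 1 := by
    have h := trace_mul_conjTranspose_mul_self 1 B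
    rw [Matrix.one_mul, hρtr] at h
    have h' := congrArg Complex.re h
    simp only [one_mulVec, Complex.re_sum, hnorm, Complex.one_re] at h'
    exact h'.symm
  set F := ∑ k, ‖star ψ ⬝ᵥ star (B k)‖ ^ 2 with hF
  have hfid : ε ^ 2 / 4 ≤ 1 - F := by
    have h := hε'.trans (traceNorm_vecMulVec_sub_le ψ hψ B hB hA)
    have h2 : ε / 2 ≤ √(1 - F) := by linarith
    have h3 := (Real.le_sqrt' (by positivity)).mp h2
    linarith
  have henergy : lam + Δ * (1 - F) ≤ (H * (Bᴴ * B)).trace.re := by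
    rw [trace_mul_conjTranspose_mul_self, Complex.re_sum]
    refine le_trans (le_of_eq ?_)
      (Finset.sum_le_sum fun k _ => gap_energy_le hHH hψ hground hgap (star (B k)))
    simp only [hnorm, Finset.sum_add_distrib, ← Finset.mul_sum, Finset.sum_sub_distrib, hB, ← hF,
      mul_one]
  have hground' : (H * vecMulVec ψ (star ψ)).trace.re = lam := by
    rw [mul_vecMulVec, hground, trace_vecMulVec, smul_dotProduct, dotProduct_comm, hψ]
    simp
  have hsplit : (H * (Bᴴ * B)).trace.re - lam = -∑ i, (hmat i *
      (reduce (vecMulVec ψ (star ψ)) (s i) - reduce (Bᴴ * B) (s i))).trace.re := by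
    rw [← hground', hH]
    simp only [Matrix.sum_mul, trace_sum, trace_liftMat_mul, Complex.re_sum, Matrix.mul_sub,
      trace_sub, Complex.sub_re, Finset.sum_sub_distrib]
    ring
  have hbound : Δ * (ε ^ 2 / 4) ≤ ∑ i, traceNorm (hAs i) := by
    calc
      Δ * (ε ^ 2 / 4) ≤ Δ * (1 - F) := by gcongr
      _ ≤ (H * (Bᴴ * B)).trace.re - lam := by linarith
      _ ≤ _ := by
        rw [hsplit, ← Finset.sum_neg_distrib]
        exact Finset.sum_le_sum fun i _ => (neg_le_abs _).trans
          (abs_trace_mul_re_le_traceNorm (hpos i) (hle i) (hAs i))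
  have hεΔ : 0 < Δ * (ε ^ 2 / 4) := by positivity
  rcases Nat.eq_zero_or_pos m with rfl | hm
  · simp only [Finset.univ_eq_empty, Finset.sum_empty] at hbound
    linarith
  · have : Nonempty (Fin m) := ⟨⟨0, hm⟩⟩
    have hlt := Finset.sum_lt_sum_of_nonempty Finset.univ_nonempty fun i _ => hloc i
    have hm' : (m : ℝ) ≠ 0 := by positivity
    rw [Finset.sum_const, Finset.card_univ, Fintype.card_fin, nsmul_eq_mul] at hlt
    have : (m : ℝ) * (Δ * ε ^ 2 / (4 * m)) = Δ * (ε ^ 2 / 4) := by field_simp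
    linarith
end

section
/- Let s₁,…,s_m be subsets of the n sites and let ψ be a unit vector in the n-qubit space such that ψψ† is UDA by its reduced density matrices on s₁,…,s_m. Then the tuple ((ψψ†)_{s₁},…,(ψψ†)_{s_m}) is an extreme point (over the real scalars) of the convex set ℛ. -/
open Matrix
open scoped ComplexOrder

/-- `ρ` is a density matrix: positive semidefinite with trace 1. -/
def IsDensityMatrix {d : Type*} [Fintype d] (ρ : Matrix d d ℂ) : Prop :=
  ρ.PosSemidef ∧ ρ.trace = 1

/-- The convex set `ℛ` of tuples of reduced density matrices on the subsets
`s 0, …, s (m-1)`, as `ρ` ranges over all `n`-qubit density matrices. -/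
noncomputable def RSet (n m : ℕ) (s : Fin m → Finset (Fin n)) :
    Set (∀ i : Fin m, Matrix (↥(s i) → Fin 2) (↥(s i) → Fin 2) ℂ) :=
  {t | ∃ ρ : QMatrix n, IsDensityMatrix ρ ∧ ∀ i, reduce ρ (s i) = t i}

theorem reduce_add {n : ℕ} (ρ σ : QMatrix n) (s : Finset (Fin n)) :
    reduce (ρ + σ) s = reduce ρ s + reduce σ s := by
  ext f g
  simp [reduce, Finset.sum_add_distrib]

theorem reduce_smul {n : ℕ} (a : ℝ) (ρ : QMatrix n) (s : Finset (Fin n)) :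
    reduce (a • ρ) s = a • reduce ρ s := by
  ext f g
  simp [reduce, Finset.mul_sum]

/-- A convex combination of density matrices is a density matrix. -/
theorem IsDensityMatrix.convexComb {d : Type*} [Fintype d] {ρ σ : Matrix d d ℂ}
    (hρ : IsDensityMatrix ρ) (hσ : IsDensityMatrix σ) {a b : ℝ}
    (ha : 0 ≤ a) (hb : 0 ≤ b) (hab : a + b = 1) : IsDensityMatrix (a • ρ + b • σ) := by
  refine ⟨(hρ.1.smul ha).add (hσ.1.smul hb), ?_⟩
  rw [trace_add, trace_smul, trace_smul, hρ.2, hσ.2, ← add_smul, hab, one_smul]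

/-- A density matrix that annihilates the orthogonal complement of a unit vector `ψ`
is the pure state `ψψ†`. -/
theorem IsDensityMatrix.eq_vecMulVec {d : Type*} [Fintype d] {ρ : Matrix d d ℂ}
    (hρ : IsDensityMatrix ρ) {ψ : d → ℂ} (hψ : star ψ ⬝ᵥ ψ = 1)
    (h : ∀ v, star ψ ⬝ᵥ v = 0 → ρ *ᵥ v = 0) : ρ = vecMulVec ψ (star ψ) := by
  classical
  set P := vecMulVec ψ (star ψ) with hP
  have hPv (v : d → ℂ) : P *ᵥ v = (star ψ ⬝ᵥ v) • ψ := by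
    rw [hP, vecMulVec_mulVec, op_smul_eq_smul]
  have hright : ρ = ρ * P := by
    refine ext_of_mulVec_single fun i => ?_
    set v : d → ℂ := Pi.single i 1
    have hv : star ψ ⬝ᵥ (v - P *ᵥ v) = 0 := by
      rw [hPv, dotProduct_sub, dotProduct_smul, hψ, smul_eq_mul, mul_one, sub_self]
    have := h _ hv
    rwa [mulVec_sub, sub_eq_zero, mulVec_mulVec] at this
  have hPherm : Pᴴ = P := by rw [hP, conjTranspose_vecMulVec, star_star]
  have hleft : ρ = P * ρ := by
    have := congrArg conjTranspose hright
    rwa [conjTranspose_mul, hρ.1.isHermitian.eq, hPherm] at this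
  have hscalar : ρ = (star ψ ⬝ᵥ ρ *ᵥ ψ) • P := by
    calc ρ = P * (ρ * P) := by rw [← hright, ← hleft]
      _ = vecMulVec (P *ᵥ (ρ *ᵥ ψ)) (star ψ) := by
        rw [hP, mul_vecMulVec, mul_vecMulVec]
      _ = _ := by rw [hPv, smul_vecMulVec]
  have htrace := hρ.2
  rw [hscalar, trace_smul, hP, trace_vecMulVec, dotProduct_comm ψ, hψ, smul_eq_mul,
    mul_one] at htrace
  rw [hscalar, htrace, one_smul]

/-- A pure state is an extreme point of the set of density matrices. -/
theorem IsDensityMatrix.eq_vecMulVec_of_convexComb {d : Type*} [Fintype d]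
    {ρ σ : Matrix d d ℂ} (hρ : IsDensityMatrix ρ) (hσ : IsDensityMatrix σ)
    {ψ : d → ℂ} (hψ : star ψ ⬝ᵥ ψ = 1) {a b : ℝ} (ha : 0 < a) (hb : 0 ≤ b)
    (h : a • ρ + b • σ = vecMulVec ψ (star ψ)) : ρ = vecMulVec ψ (star ψ) := by
  refine hρ.eq_vecMulVec hψ fun v hv => ?_
  have hsum : a • (star v ⬝ᵥ ρ *ᵥ v) + b • (star v ⬝ᵥ σ *ᵥ v) = 0 := by
    have := congrArg (fun A : Matrix d d ℂ => star v ⬝ᵥ A *ᵥ v) h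
    simpa [add_mulVec, smul_mulVec, vecMulVec_mulVec, hv] using this
  have hρv := hρ.1.dotProduct_mulVec_nonneg v
  have hσv := hσ.1.dotProduct_mulVec_nonneg v
  have hzero := ((add_eq_zero_iff_of_nonneg (smul_nonneg ha.le hρv)
    (smul_nonneg hb hσv)).mp hsum).1
  exact (hρ.1.dotProduct_mulVec_zero_iff v).mp
    ((smul_eq_zero.mp hzero).resolve_left ha.ne')

/-- If the pure state `ψψ†` is UDA by its reduced density matrices on
`s 0, …, s (m-1)`, then the tuple of its reduced density matrices is an extreme point
(over the real scalars) of the convex set `ℛ`. -/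
theorem extremePoint_of_UDA
    (n m : ℕ) (s : Fin m → Finset (Fin n))
    (ψ : QConf n → ℂ) (hψ : star ψ ⬝ᵥ ψ = 1)
    (hUDA : ∀ ρ : QMatrix n, IsDensityMatrix ρ →
      (∀ i, reduce ρ (s i) = reduce (vecMulVec ψ (star ψ)) (s i)) →
      ρ = vecMulVec ψ (star ψ)) :
    (fun i => reduce (vecMulVec ψ (star ψ)) (s i)) ∈
      Set.extremePoints ℝ (RSet n m s) := by
  refine ⟨⟨_, ⟨posSemidef_vecMulVec_self_star ψ, ?_⟩, fun _ => rfl⟩, ?_⟩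
  · rw [trace_vecMulVec, dotProduct_comm, hψ]
  · rintro x ⟨ρ, hρ, hρx⟩ y ⟨σ, hσ, hσy⟩ ⟨a, b, ha, hb, hab, hxy⟩
    have hpure := hUDA _ (hρ.convexComb hσ ha.le hb.le hab) fun i => by
      rw [reduce_add, reduce_smul, reduce_smul, hρx, hσy]
      exact congrFun hxy i
    funext i
    rw [← hρx, hρ.eq_vecMulVec_of_convexComb hσ hψ ha hb.le hpure]
end

section
/- Take n = 2 qubits and the single subset s = {0} (the first site). Then: (1) the 1-qubit matrix |0⟩⟨0| is an exposed point (over the real scalars) of the set ℛ = {ρ_s : ρ a 2-qubit density matrix}; and (2) there exist two distinct 2-qubit pure density matrices φ ≠ φ' (for instance the pure states |0⟩⊗|0⟩ and |0⟩⊗(|0⟩+|1⟩)/√2) with φ_s = φ'_s = |0⟩⟨0|. Hence an exposed point of ℛ does not imply that a compatible pure state is UDA, or even UDP. -/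
open Matrix
open scoped ComplexOrder

/-- `φ` is a pure state: `φ = ψψ†` for some unit vector `ψ`. -/
def IsPureState {d : Type*} [Fintype d] (φ : Matrix d d ℂ) : Prop :=
  ∃ ψ : d → ℂ, star ψ ⬝ᵥ ψ = 1 ∧ φ = vecMulVec ψ (star ψ)

/-- The single-qubit projector `|0⟩⟨0|` on the sites of `s`. -/
def projZero (s : Finset (Fin 2)) : Matrix (↥s → Fin 2) (↥s → Fin 2) ℂ :=
  fun f g => if f = (fun _ => 0) ∧ g = (fun _ => 0) then 1 else 0

/-- The partial trace is a sum of diagonal blocks. -/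
theorem reduce_eq_sum_submatrix {n : ℕ} (ρ : QMatrix n) (s : Finset (Fin n)) :
    reduce ρ s = ∑ h : ↥sᶜ → Fin 2,
      ρ.submatrix (fun f => mergeConf s f h) (fun f => mergeConf s f h) := by
  ext f g
  simp [reduce, Matrix.sum_apply]

theorem Matrix.PosSemidef.reduce {n : ℕ} {ρ : QMatrix n} (hρ : ρ.PosSemidef)
    (s : Finset (Fin n)) : (reduce ρ s).PosSemidef := by
  rw [reduce_eq_sum_submatrix]
  exact Matrix.posSemidef_sum _ fun h _ => hρ.submatrix _

theorem mergeConf_bijective {n : ℕ} (s : Finset (Fin n)) :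
    Function.Bijective fun p : (↥s → Fin 2) × (↥sᶜ → Fin 2) => mergeConf s p.1 p.2 := by
  constructor
  · rintro ⟨f, h⟩ ⟨f', h'⟩ heq
    refine Prod.ext (funext fun i => ?_) (funext fun i => ?_)
    · simpa [mergeConf] using congrFun heq i
    · simpa [mergeConf, Finset.mem_compl.mp i.2] using congrFun heq i
  · intro F
    refine ⟨(fun i => F i, fun i => F i), ?_⟩
    ext i
    simp [mergeConf]

theorem trace_reduce {n : ℕ} (ρ : QMatrix n) (s : Finset (Fin n)) :
    (reduce ρ s).trace = ρ.trace := by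
  simp only [Matrix.trace, Matrix.diag_apply, reduce]
  rw [← Fintype.sum_prod_type']
  exact (mergeConf_bijective s).sum_comp fun F => ρ F F

theorem IsDensityMatrix.reduce {n : ℕ} {ρ : QMatrix n} (hρ : IsDensityMatrix ρ)
    (s : Finset (Fin n)) : IsDensityMatrix (reduce ρ s) :=
  ⟨hρ.1.reduce s, (trace_reduce ρ s).trans hρ.2⟩

theorem IsPureState.isDensityMatrix {d : Type*} [Fintype d] {φ : Matrix d d ℂ}
    (hφ : IsPureState φ) : IsDensityMatrix φ := by
  obtain ⟨ψ, hψ, rfl⟩ := hφ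
  refine ⟨Matrix.posSemidef_vecMulVec_self_star ψ, ?_⟩
  rw [Matrix.trace_vecMulVec, dotProduct_comm, hψ]

/-- A vanishing diagonal entry of a positive semidefinite matrix forces its column to vanish. -/
theorem Matrix.PosSemidef.apply_eq_zero_of_diag_eq_zero {d : Type*} [Fintype d]
    {A : Matrix d d ℂ} (hA : A.PosSemidef) {j : d} (hj : A j j = 0) (i : d) : A i j = 0 := by
  classical
  have h := (hA.dotProduct_mulVec_zero_iff (Pi.single j 1)).1 (by simp [hj])
  simpa using congrFun h i

theorem IsDensityMatrix.re_apply_self_le_one {d : Type*} [Fintype d] {A : Matrix d d ℂ}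
    (hA : IsDensityMatrix A) (i : d) : (A i i).re ≤ 1 := by
  have htr : ∑ k, (A k k).re = 1 := by simpa [Matrix.trace] using congrArg Complex.re hA.2
  rw [← htr]
  exact Finset.single_le_sum (f := fun k => (A k k).re)
    (fun k _ => (Complex.nonneg_iff.1 hA.1.diag_nonneg).1) (Finset.mem_univ i)

/-- A density matrix with a diagonal entry at least `1` is the corresponding rank-one projector. -/
theorem IsDensityMatrix.eq_single {d : Type*} [Fintype d] [DecidableEq d] {A : Matrix d d ℂ}
    (hA : IsDensityMatrix A) {i : d} (hi : 1 ≤ (A i i).re) : A = Matrix.single i i 1 := by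
  have hnn : ∀ k, 0 ≤ (A k k).re := fun k => (Complex.nonneg_iff.1 hA.1.diag_nonneg).1
  have htr : ∑ k, (A k k).re = 1 := by simpa [Matrix.trace] using congrArg Complex.re hA.2
  have hdiag : ∀ j, j ≠ i → A j j = 0 := by
    intro j hj
    have hle : (A i i).re + (A j j).re ≤ ∑ k, (A k k).re := by
      rw [← Finset.sum_pair (f := fun k => (A k k).re) hj.symm]
      exact Finset.sum_le_sum_of_subset_of_nonneg (Finset.subset_univ _) fun k _ _ => hnn k
    refine Complex.ext ?_ (Complex.nonneg_iff.1 (hA.1.diag_nonneg (i := j))).2.symm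
    exact le_antisymm (by simp only [Complex.zero_re]; linarith) (hnn j)
  have hii : A i i = 1 := by
    exact (Fintype.sum_eq_single i hdiag).symm.trans hA.2
  ext k l
  by_cases hl : l = i
  · by_cases hk : k = i
    · simp [hk, hl, hii]
    · rw [← hA.1.isHermitian.apply k l, hA.1.apply_eq_zero_of_diag_eq_zero (hdiag k hk)]
      simp [Ne.symm hk]
  · rw [hA.1.apply_eq_zero_of_diag_eq_zero (hdiag l hl)]
    simp [Ne.symm hl]

theorem projZero_eq_single (s : Finset (Fin 2)) :
    projZero s = Matrix.single (fun _ => 0) (fun _ => 0) 1 := by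
  ext f g
  simp only [projZero, Matrix.single_apply, eq_comm]

theorem isPureState_single {d : Type*} [Fintype d] [DecidableEq d] (i : d) :
    IsPureState (Matrix.single i i (1 : ℂ)) := by
  refine ⟨Pi.single i 1, by simp, ?_⟩
  rw [← Pi.single_star, star_one, ← Matrix.single_eq_single_vecMulVec_single]

/-- Each basis state `|0⟩ ⊗ |b⟩` has reduced state `|0⟩⟨0|` on the first site. -/
theorem reduce_single_zero (b : Fin 2) :
    reduce (Matrix.single ![0, b] ![0, b] 1 : QMatrix 2) {0} = projZero {0} := by
  have hmerge : ∀ (b : Fin 2) (f : ↥({0} : Finset (Fin 2)) → Fin 2)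
      (h : ↥({0} : Finset (Fin 2))ᶜ → Fin 2),
      ![0, b] = mergeConf {0} f h ↔ f = (fun _ => 0) ∧ h = (fun _ => b) := by decide
  ext f g
  simp only [reduce, projZero, Matrix.single_apply, hmerge]
  rw [Finset.sum_eq_single fun _ => b] <;> simp +contextual

/-- For `n = 2` qubits and the single subset `s = {0}`:
(1) the 1-qubit matrix `|0⟩⟨0|` is an exposed point (over the real scalars) of the set
`ℛ = {ρ_s : ρ a 2-qubit density matrix}`, and
(2) there exist two distinct 2-qubit pure density matrices `φ ≠ φ'` whose reduced
density matrices on `s` are both `|0⟩⟨0|`.  Hence being an exposed point of `ℛ` does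
not imply that a compatible pure state is UDA, or even UDP. -/
theorem exposed_not_imp_UDA :
    projZero {0} ∈ Set.exposedPoints ℝ
      {t : Matrix (↥({0} : Finset (Fin 2)) → Fin 2) (↥({0} : Finset (Fin 2)) → Fin 2) ℂ |
        ∃ ρ : QMatrix 2, IsDensityMatrix ρ ∧ reduce ρ {0} = t} ∧
    ∃ φ φ' : QMatrix 2, IsPureState φ ∧ IsPureState φ' ∧ φ ≠ φ' ∧
      reduce φ {0} = projZero {0} ∧ reduce φ' {0} = projZero {0} := by
  have hpure := isPureState_single (![0, 0] : QConf 2)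
  refine ⟨⟨⟨_, hpure.isDensityMatrix, reduce_single_zero 0⟩, ?_⟩, _, _, hpure,
    isPureState_single ![0, 1], fun heq => ?_, reduce_single_zero 0, reduce_single_zero 1⟩
  · refine ⟨⟨Complex.reLm ∘ₗ Matrix.entryLinearMap ℝ ℂ (fun _ => 0) (fun _ => 0), ?_⟩, ?_⟩
    · exact Complex.continuous_re.comp (continuous_id.matrix_elem _ _)
    · rintro _ ⟨ρ, hρ, rfl⟩
      have hred := hρ.reduce {0}
      have hone : (projZero {0} (fun _ => 0) (fun _ => 0)).re = 1 := by simp [projZero]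
      change (reduce ρ {0} _ _).re ≤ (projZero {0} _ _).re ∧
        ((projZero {0} _ _).re ≤ (reduce ρ {0} _ _).re → _)
      rw [hone, projZero_eq_single]
      exact ⟨hred.re_apply_self_le_one _, hred.eq_single⟩
  · simpa [Matrix.single_apply] using congrFun (congrFun heq ![0, 0]) ![0, 0]
end

section
/- Let n ≥ 2. Let g be the n-qubit GHZ unit vector g = (e_{0…0} + e_{1…1})/√2, where e_{0…0} and e_{1…1} are the standard basis vectors at the all-zero and all-one functions, and let σ = ½(e_{0…0}e_{0…0}† + e_{1…1}e_{1…1}†). Then gg† ≠ σ, yet for every site i, taking s to be the set of all sites except i, one has (gg†)_s = σ_s. Consequently the GHZ state gg† is not UDA by its (n−1)-qubit reduced density matrices. -/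
open Matrix
open scoped ComplexOrder

/-- The standard basis vector of the `n`-qubit space at the configuration `x`. -/
def basisVec {n : ℕ} (x : QConf n) : QConf n → ℂ :=
  fun y => if y = x then 1 else 0

/-- The `n`-qubit GHZ unit vector `(e_{0…0} + e_{1…1})/√2`. -/
noncomputable def ghzVec (n : ℕ) : QConf n → ℂ :=
  (((Real.sqrt 2 : ℝ) : ℂ))⁻¹ • (basisVec (fun _ => 0) + basisVec (fun _ => 1))

/-- The mixture `½(e_{0…0}e_{0…0}† + e_{1…1}e_{1…1}†)`. -/
noncomputable def ghzMix (n : ℕ) : QMatrix n :=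
  (2 : ℂ)⁻¹ • (vecMulVec (basisVec (fun _ => 0)) (star (basisVec (fun _ => 0))) +
    vecMulVec (basisVec (fun _ => 1)) (star (basisVec (fun _ => 1))))

theorem star_basisVec {n : ℕ} (x : QConf n) : star (basisVec x) = basisVec x := by
  ext y
  simp [basisVec, apply_ite]

theorem trace_vecMulVec_basisVec {n : ℕ} (x : QConf n) :
    (vecMulVec (basisVec x) (star (basisVec x))).trace = 1 := by
  simp [star_basisVec, Matrix.trace, vecMulVec_apply, basisVec]

theorem ghzMix_posSemidef (n : ℕ) : (ghzMix n).PosSemidef :=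
  ((posSemidef_vecMulVec_self_star _).add (posSemidef_vecMulVec_self_star _)).smul
    (by positivity)

theorem trace_ghzMix (n : ℕ) : (ghzMix n).trace = 1 := by
  rw [ghzMix, trace_smul, trace_add, trace_vecMulVec_basisVec, trace_vecMulVec_basisVec]
  norm_num

/-- The GHZ projector is the mixture plus its two off-diagonal coherences. -/
theorem vecMulVec_ghzVec_apply {n : ℕ} (x y : QConf n) :
    vecMulVec (ghzVec n) (star (ghzVec n)) x y = ghzMix n x y +
      (2 : ℂ)⁻¹ * (basisVec (fun _ => 0) x * basisVec (fun _ => 1) y +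
        basisVec (fun _ => 1) x * basisVec (fun _ => 0) y) := by
  have h : (((Real.sqrt 2 : ℝ) : ℂ))⁻¹ * (((Real.sqrt 2 : ℝ) : ℂ))⁻¹ = 2⁻¹ := by
    rw [← mul_inv, ← Complex.ofReal_mul, Real.mul_self_sqrt zero_le_two, Complex.ofReal_ofNat]
  have hs : star (((Real.sqrt 2 : ℝ) : ℂ))⁻¹ = (((Real.sqrt 2 : ℝ) : ℂ))⁻¹ := by
    simp
  simp only [ghzVec, ghzMix, star_smul, star_add, star_basisVec, hs, vecMulVec_apply,
    Matrix.smul_apply, Matrix.add_apply, Pi.smul_apply, Pi.add_apply, smul_eq_mul]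
  rw [← h]
  ring

/-- Distinct constant configurations cannot both occur at configurations agreeing at a site. -/
theorem basisVec_const_mul_eq_zero {n : ℕ} {x y : QConf n} {i : Fin n} (hxy : x i = y i)
    {a b : Fin 2} (hab : a ≠ b) :
    basisVec (fun _ => a) x * basisVec (fun _ => b) y = 0 := by
  unfold basisVec
  split_ifs with hx hy
  · subst hx hy
    exact absurd hxy hab
  all_goals simp

theorem reduce_ghz_eq_reduce_ghzMix {n : ℕ} {s : Finset (Fin n)} {i : Fin n} (hi : i ∉ s) :
    reduce (vecMulVec (ghzVec n) (star (ghzVec n))) s = reduce (ghzMix n) s := by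
  ext f g
  refine Finset.sum_congr rfl fun h _ => ?_
  have hfg : mergeConf s f h i = mergeConf s g h i := by simp [mergeConf, hi]
  rw [vecMulVec_ghzVec_apply, basisVec_const_mul_eq_zero hfg zero_ne_one,
    basisVec_const_mul_eq_zero hfg one_ne_zero]
  simp

theorem vecMulVec_ghzVec_ne_ghzMix {n : ℕ} (hn : n ≠ 0) :
    vecMulVec (ghzVec n) (star (ghzVec n)) ≠ ghzMix n := by
  intro h
  have : NeZero n := ⟨hn⟩
  have h01 := vecMulVec_ghzVec_apply (n := n) (fun _ => 0) (fun _ => 1)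
  rw [h] at h01
  simp [basisVec, funext_iff] at h01

/-- For `n ≥ 2`, the GHZ pure state `gg†` differs from the mixture `σ`,
yet for every site `i` they have the same reduced density matrix on the complement of
`{i}`.  Consequently the GHZ state is not UDA by its `(n−1)`-qubit reduced density
matrices. -/
theorem ghz_not_UDA (n : ℕ) (hn : 2 ≤ n) :
    vecMulVec (ghzVec n) (star (ghzVec n)) ≠ ghzMix n ∧
    (∀ i : Fin n,
      reduce (vecMulVec (ghzVec n) (star (ghzVec n))) ({i}ᶜ) = reduce (ghzMix n) ({i}ᶜ)) ∧
    ¬ (∀ ρ : QMatrix n, ρ.PosSemidef → ρ.trace = 1 →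
        (∀ i : Fin n,
          reduce ρ ({i}ᶜ) = reduce (vecMulVec (ghzVec n) (star (ghzVec n))) ({i}ᶜ)) →
        ρ = vecMulVec (ghzVec n) (star (ghzVec n))) := by
  have hne := vecMulVec_ghzVec_ne_ghzMix (n := n) (by omega)
  have hred : ∀ i : Fin n,
      reduce (vecMulVec (ghzVec n) (star (ghzVec n))) ({i}ᶜ) = reduce (ghzMix n) ({i}ᶜ) :=
    fun i => reduce_ghz_eq_reduce_ghzMix (i := i) (by simp)
  exact ⟨hne, hred, fun h =>
    hne (h _ (ghzMix_posSemidef n) (trace_ghzMix n) fun i => (hred i).symm).symm⟩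
end

section
/- For n ≥ 0, define the n-qubit Pauli operator P a, for a : Fin n → Fin 4, as the n-qubit matrix with entries (P a) f g = Πᵢ σ_{a i} (f i) (g i), where σ₀ = σ_I, σ₁ = σ_X, σ₂ = σ_Y, σ₃ = σ_Z are the 2 × 2 identity and Pauli matrices. Then for all a, b : Fin n → Fin 4, Tr(P a · P b) = 2ⁿ if a = b and 0 otherwise. -/
open Matrix

/-- The single-qubit Pauli matrices `σ₀ = σ_I`, `σ₁ = σ_X`, `σ₂ = σ_Y`, `σ₃ = σ_Z`
(with the convention `σ_Y = [[0,i],[−i,0]]`). -/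
def pauli : Fin 4 → Matrix (Fin 2) (Fin 2) ℂ :=
  ![!![1, 0; 0, 1], !![0, 1; 1, 0], !![0, Complex.I; -Complex.I, 0], !![1, 0; 0, -1]]

/-- The `n`-qubit Pauli operator `P a` for `a : Fin n → Fin 4`, with entries
`(P a) f g = Πᵢ σ_{a i} (f i) (g i)`. -/
def pauliOp (n : ℕ) (a : Fin n → Fin 4) :
    Matrix (Fin n → Fin 2) (Fin n → Fin 2) ℂ :=
  fun f g => ∏ i, pauli (a i) (f i) (g i)

/-- The single-qubit Pauli matrices are orthogonal for the trace form. -/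
lemma trace_pauli_mul (a b : Fin 4) :
    (pauli a * pauli b).trace = if a = b then (2 : ℂ) else 0 := by
  fin_cases a <;> fin_cases b <;>
    simp [pauli, Matrix.trace_fin_two] <;> norm_num

/-- The trace of a product of Pauli operators factors over the qubits. -/
lemma trace_pauliOp_mul_eq_prod (n : ℕ) (a b : Fin n → Fin 4) :
    (pauliOp n a * pauliOp n b).trace = ∏ i, (pauli (a i) * pauli (b i)).trace := by
  simp only [Matrix.trace, Matrix.diag_apply, Matrix.mul_apply, pauliOp,
    ← Finset.prod_mul_distrib, Fintype.prod_sum]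

/-- The `n`-qubit Pauli operators are orthogonal:
`Tr(P a · P b) = 2ⁿ` if `a = b` and `0` otherwise. -/
theorem trace_pauliOp_mul (n : ℕ) (a b : Fin n → Fin 4) :
    (pauliOp n a * pauliOp n b).trace = if a = b then (2 : ℂ) ^ n else 0 := by
  rw [trace_pauliOp_mul_eq_prod]
  simp only [trace_pauli_mul]
  split_ifs with h
  · simp [h]
  · obtain ⟨i, hi⟩ := Function.ne_iff.mp h
    exact Finset.prod_eq_zero (Finset.mem_univ i) (if_neg hi)
end
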